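/- Let g be a metric on the connected open set U and let K be a Killing tensor for g. If K vanishes up to order 2 at some point p ∈ U (that is, K(p) = 0 and all first and second order partial derivatives of all components of K vanish at p), then K is identically zero on U. -/

import Mathlib

open Matrix

noncomputable section

/-- Partial derivative in the `i`-th coordinate direction of a real-valued function on `ℝⁿ`. -/
def pd {n : ℕ} (i : Fin n) (f : (Fin n → ℝ) → ℝ) : (Fin n → ℝ) → ℝ :=
  fun x => fderiv ℝ f x (Pi.single i 1)

/-- Iterated partial derivatives along a list of coordinate directions. -/
def iterPD {n : ℕ} : List (Fin n) → ((Fin n → ℝ) → ℝ) → ((Fin n → ℝ) → ℝ)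
  | [], f => f
  | i :: l, f => pd i (iterPD l f)

/-- `g` is a (pseudo-Riemannian) metric on `U`: a smooth field of invertible symmetric
real `n×n` matrices. -/
structure IsMetricOn {n : ℕ} (U : Set (Fin n → ℝ))
    (g : (Fin n → ℝ) → Matrix (Fin n) (Fin n) ℝ) : Prop where
  smooth : ∀ i j : Fin n, ContDiffOn ℝ (⊤ : ℕ∞) (fun x => g x i j) U
  symm : ∀ x ∈ U, (g x).IsSymm
  nondeg : ∀ x ∈ U, IsUnit (g x).det

/-- The Christoffel symbols `Γ^k_{ij}` of the metric `g`. -/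
def Gamma {n : ℕ} (g : (Fin n → ℝ) → Matrix (Fin n) (Fin n) ℝ)
    (k i j : Fin n) (x : Fin n → ℝ) : ℝ :=
  (1/2) * ∑ ℓ, (g x)⁻¹ k ℓ *
    (pd i (fun y => g y ℓ j) x + pd j (fun y => g y ℓ i) x - pd ℓ (fun y => g y i j) x)

/-- An open interval of `ℝ` (possibly empty or unbounded): an open order-connected set. -/
def IsOpenInterval (I : Set ℝ) : Prop := IsOpen I ∧ I.OrdConnected

/-- `γ` is a `g`-geodesic defined on the open interval `I`, with values in `U`. -/
structure IsGeodesicOn {n : ℕ} (U : Set (Fin n → ℝ))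
    (g : (Fin n → ℝ) → Matrix (Fin n) (Fin n) ℝ)
    (γ : ℝ → (Fin n → ℝ)) (I : Set ℝ) : Prop where
  interval : IsOpenInterval I
  smooth : ∀ k : Fin n, ContDiffOn ℝ (⊤ : ℕ∞) (fun s => γ s k) I
  mem : ∀ t ∈ I, γ t ∈ U
  eqn : ∀ t ∈ I, ∀ k : Fin n,
    deriv (deriv fun s => γ s k) t
      + ∑ i, ∑ j, Gamma g k i j (γ t) * deriv (fun s => γ s i) t * deriv (fun s => γ s j) t = 0

/-- `g` and `gbar` are projectively equivalent on `U`: every `g`-geodesic with nowhere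
vanishing velocity becomes, after a smooth reparameterization (a diffeomorphism of open
intervals), a `gbar`-geodesic. -/
def ProjEquiv {n : ℕ} (U : Set (Fin n → ℝ))
    (g gbar : (Fin n → ℝ) → Matrix (Fin n) (Fin n) ℝ) : Prop :=
  ∀ (γ : ℝ → (Fin n → ℝ)) (I : Set ℝ), IsGeodesicOn U g γ I →
    (∀ t ∈ I, ∃ k, deriv (fun s => γ s k) t ≠ 0) →
    ∃ (φ : ℝ → ℝ) (J : Set ℝ), IsOpenInterval J ∧ ContDiffOn ℝ (⊤ : ℕ∞) φ J ∧
      Set.InjOn φ J ∧ φ '' J = I ∧ (∀ t ∈ J, deriv φ t ≠ 0) ∧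
      IsGeodesicOn U gbar (γ ∘ φ) J

/-- The (1,1)-tensor `L = |det gbar / det g|^{1/(n+1)} gbar⁻¹ g` built from `g` and `gbar`. -/
def Lfield {n : ℕ} (g gbar : (Fin n → ℝ) → Matrix (Fin n) (Fin n) ℝ)
    (x : Fin n → ℝ) : Matrix (Fin n) (Fin n) ℝ :=
  |(gbar x).det / (g x).det| ^ ((1 : ℝ)/((n : ℝ)+1)) • ((gbar x)⁻¹ * g x)

/-- The family `S(t) = adjugate (t·Id − L)`. -/
def Sfield {n : ℕ} (g gbar : (Fin n → ℝ) → Matrix (Fin n) (Fin n) ℝ) (t : ℝ)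
    (x : Fin n → ℝ) : Matrix (Fin n) (Fin n) ℝ :=
  (t • (1 : Matrix (Fin n) (Fin n) ℝ) - Lfield g gbar x).adjugate

/-- The second order operator associated (via Carter's quantization) to a field `A` of
symmetric matrices: `Â f = |det g|^{-1/2} ∑ᵢⱼ ∂ᵢ(|det g|^{1/2} Aⁱʲ ∂ⱼ f)`. -/
def assocOp {n : ℕ} (g A : (Fin n → ℝ) → Matrix (Fin n) (Fin n) ℝ)
    (f : (Fin n → ℝ) → ℝ) (x : Fin n → ℝ) : ℝ :=
  |(g x).det| ^ (-(1 : ℝ)/2) * ∑ i, ∑ j,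
    pd i (fun y => |(g y).det| ^ ((1 : ℝ)/2) * A y i j * pd j f y) x

/-- The operator `K̂^{(t)}`, associated to `A = S(t)·g⁻¹`. -/
def Khat {n : ℕ} (g gbar : (Fin n → ℝ) → Matrix (Fin n) (Fin n) ℝ) (t : ℝ)
    (f : (Fin n → ℝ) → ℝ) (x : Fin n → ℝ) : ℝ :=
  assocOp g (fun y => Sfield g gbar t y * (g y)⁻¹) f x

/-- The Beltrami-Laplace operator of `g`, associated to `A = g⁻¹`. -/
def LaplaceOp {n : ℕ} (g : (Fin n → ℝ) → Matrix (Fin n) (Fin n) ℝ)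
    (f : (Fin n → ℝ) → ℝ) (x : Fin n → ℝ) : ℝ :=
  assocOp g (fun y => (g y)⁻¹) f x

/-- `K` is a Killing tensor for `g` on `U`: the associated quadratic function is constant
along every `g`-geodesic. -/
def IsKillingTensorOn {n : ℕ} (U : Set (Fin n → ℝ))
    (g K : (Fin n → ℝ) → Matrix (Fin n) (Fin n) ℝ) : Prop :=
  ∀ (γ : ℝ → (Fin n → ℝ)) (I : Set ℝ), IsGeodesicOn U g γ I →
    ∀ τ₁ ∈ I, ∀ τ₂ ∈ I,
      (∑ i, ∑ j, deriv (fun s => γ s i) τ₁ * K (γ τ₁) i j * deriv (fun s => γ s j) τ₁) =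
      (∑ i, ∑ j, deriv (fun s => γ s i) τ₂ * K (γ τ₂) i j * deriv (fun s => γ s j) τ₂)

/-- The covariant derivative `∇_k T_{ij}` of a (0,2)-tensor field `T`. -/
def covDeriv2 {n : ℕ} (g T : (Fin n → ℝ) → Matrix (Fin n) (Fin n) ℝ)
    (k i j : Fin n) (x : Fin n → ℝ) : ℝ :=
  pd k (fun y => T y i j) x - (∑ s, Gamma g s k i x * T x s j)
    - ∑ s, Gamma g s k j x * T x i s

/-- The Ricci curvature tensor `R_{ij}` of `g`. -/
def Ricci {n : ℕ} (g : (Fin n → ℝ) → Matrix (Fin n) (Fin n) ℝ)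
    (i j : Fin n) (x : Fin n → ℝ) : ℝ :=
  (∑ ℓ, pd ℓ (fun y => Gamma g ℓ i j y) x) - (∑ ℓ, pd i (fun y => Gamma g ℓ ℓ j y) x)
    + ∑ ℓ, ∑ s, (Gamma g ℓ ℓ s x * Gamma g s i j x - Gamma g ℓ i s x * Gamma g s ℓ j x)

/-- A function vanishes up to order `k` at `p`: it and all its partial derivatives of
order `≤ k` vanish at `p`. -/
def VanishUpTo {n : ℕ} (k : ℕ) (f : (Fin n → ℝ) → ℝ) (p : Fin n → ℝ) : Prop :=
  ∀ l : List (Fin n), l.length ≤ k → iterPD l f p = 0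


/-- The plain (flat) second order operator `Â f = ∑ᵢⱼ ∂ᵢ(Aⁱʲ ∂ⱼ f)` associated to a
matrix field `A`. -/
def opPlain {n : ℕ} (A : (Fin n → ℝ) → Matrix (Fin n) (Fin n) ℝ)
    (f : (Fin n → ℝ) → ℝ) (x : Fin n → ℝ) : ℝ :=
  ∑ i, ∑ j, pd i (fun y => A y i j * pd j f y) x

end

open scoped ContDiff Topology

section PartialDerivatives

variable {n : ℕ} {U : Set (Fin n → ℝ)} {f h : (Fin n → ℝ) → ℝ} {x : Fin n → ℝ}

theorem contDiffOn_pd (hU : IsOpen U) (hf : ContDiffOn ℝ ∞ f U) (i : Fin n) :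
    ContDiffOn ℝ ∞ (pd i f) U :=
  (hf.fderiv_of_isOpen hU (m := ∞) le_rfl).clm_apply contDiffOn_const

theorem contDiffOn_iterPD (hU : IsOpen U) (hf : ContDiffOn ℝ ∞ f U) (l : List (Fin n)) :
    ContDiffOn ℝ ∞ (iterPD l f) U := by
  induction l with
  | nil => exact hf
  | cons i l ih => exact contDiffOn_pd hU ih i

theorem ContDiffOn.differentiableAt_of_mem_isOpen (hf : ContDiffOn ℝ ∞ f U) (hU : IsOpen U)
    (hx : x ∈ U) : DifferentiableAt ℝ f x :=
  (hf.contDiffAt (hU.mem_nhds hx)).differentiableAt (by simp)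

theorem eqOn_pd (hU : IsOpen U) (hfh : Set.EqOn f h U) (i : Fin n) :
    Set.EqOn (pd i f) (pd i h) U := fun x hx => by
  have : f =ᶠ[𝓝 x] h := Filter.eventuallyEq_of_mem (hU.mem_nhds hx) hfh
  simp only [pd, this.fderiv_eq]

theorem pd_comm (hU : IsOpen U) (hf : ContDiffOn ℝ ∞ f U) (i j : Fin n) :
    Set.EqOn (pd i (pd j f)) (pd j (pd i f)) U := fun x hx => by
  have hd : DifferentiableAt ℝ (fderiv ℝ f) x :=
    ((hf.fderiv_of_isOpen hU (m := ∞) le_rfl).contDiffAt (hU.mem_nhds hx)).differentiableAt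
      (by simp)
  have hs : IsSymmSndFDerivAt ℝ f x :=
    (hf.contDiffAt (hU.mem_nhds hx)).isSymmSndFDerivAt
      (by rw [minSmoothness_of_isRCLikeNormedField]
          exact WithTop.coe_le_coe.2 (le_top : (2 : ℕ∞) ≤ ⊤))
  have key (a b : Fin n) : pd a (pd b f) x =
      fderiv ℝ (fderiv ℝ f) x (Pi.single a 1) (Pi.single b 1) := by
    change fderiv ℝ (fun y => fderiv ℝ f y (Pi.single b 1)) x (Pi.single a 1) = _
    rw [fderiv_clm_apply hd (differentiableAt_const _)]
    simp
  rw [key, key, hs.eq]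

theorem pd_add (hf : DifferentiableAt ℝ f x) (hh : DifferentiableAt ℝ h x) (i : Fin n) :
    pd i (fun y => f y + h y) x = pd i f x + pd i h x := by
  simp only [pd, fderiv_fun_add hf hh, _root_.add_apply]

theorem pd_mul (hf : DifferentiableAt ℝ f x) (hh : DifferentiableAt ℝ h x) (i : Fin n) :
    pd i (fun y => f y * h y) x = pd i f x * h x + f x * pd i h x := by
  simp only [pd, fderiv_fun_mul hf hh, _root_.add_apply,
    _root_.smul_apply, smul_eq_mul]
  ring

theorem fderiv_apply_eq_sum_pd (f : (Fin n → ℝ) → ℝ) (x v : Fin n → ℝ) :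
    fderiv ℝ f x v = ∑ k, v k * pd k f x := by
  conv_lhs => rw [pi_eq_sum_univ' v]
  simp [pd, map_sum]

end PartialDerivatives

/-- `SmoothComb U F h` says that on `U` the function `h` is a finite linear combination of members
of `F` with coefficients that are smooth on `U`. -/
inductive SmoothComb {n : ℕ} (U : Set (Fin n → ℝ)) (F : Set ((Fin n → ℝ) → ℝ)) :
    ((Fin n → ℝ) → ℝ) → Prop
  | zero : SmoothComb U F (fun _ => 0)
  | mul {c f : (Fin n → ℝ) → ℝ} (hc : ContDiffOn ℝ ∞ c U) (hf : f ∈ F) :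
      SmoothComb U F (fun x => c x * f x)
  | add {h₁ h₂ : (Fin n → ℝ) → ℝ} (hh₁ : SmoothComb U F h₁) (hh₂ : SmoothComb U F h₂) :
      SmoothComb U F (fun x => h₁ x + h₂ x)
  | congr {h₁ h₂ : (Fin n → ℝ) → ℝ} (hh : SmoothComb U F h₁) (heq : Set.EqOn h₂ h₁ U) :
      SmoothComb U F h₂

namespace SmoothComb

variable {n : ℕ} {U : Set (Fin n → ℝ)} {F F' : Set ((Fin n → ℝ) → ℝ)} {h : (Fin n → ℝ) → ℝ}

theorem of_mem (hh : h ∈ F) : SmoothComb U F h :=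
  (mul (contDiffOn_const (c := (1 : ℝ))) hh).congr fun x _ => by simp

theorem mono (hFF' : F ⊆ F') (hh : SmoothComb U F h) : SmoothComb U F' h := by
  induction hh with
  | zero => exact zero
  | mul hc hf => exact mul hc (hFF' hf)
  | add _ _ h₁ h₂ => exact add h₁ h₂
  | congr _ heq ih => exact congr ih heq

theorem const_mul (a : ℝ) (hh : SmoothComb U F h) : SmoothComb U F (fun x => a * h x) := by
  induction hh with
  | zero => exact zero.congr fun x _ => by simp
  | @mul c f hc hf =>
    exact (mul (contDiffOn_const (c := a) |>.mul hc) hf).congr fun x _ => by ring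
  | add _ _ h₁ h₂ => exact (add h₁ h₂).congr fun x _ => by ring
  | congr _ heq ih => exact ih.congr fun x hx => by simp only [heq hx]

theorem sum {ι : Type*} (s : Finset ι) {H : ι → (Fin n → ℝ) → ℝ}
    (hH : ∀ i ∈ s, SmoothComb U F (H i)) : SmoothComb U F (fun x => ∑ i ∈ s, H i x) := by
  classical
  induction s using Finset.induction_on with
  | empty => simpa using zero
  | insert i s hi ih =>
    simp only [Finset.sum_insert hi]
    exact add (hH i (by simp)) (ih fun j hj => hH j (by simp [hj]))

theorem contDiffOn (hF : ∀ f ∈ F, ContDiffOn ℝ ∞ f U) (hh : SmoothComb U F h) :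
    ContDiffOn ℝ ∞ h U := by
  induction hh with
  | zero => exact contDiffOn_const
  | mul hc hf => exact hc.mul (hF _ hf)
  | add _ _ h₁ h₂ => exact h₁.add h₂
  | congr _ heq ih => exact ih.congr heq

/-- Differentiation maps combinations of `F` to combinations of `F'` as soon as it does so on `F`,
and `F ⊆ F'`. -/
theorem pd_mem (hU : IsOpen U) (hF : ∀ f ∈ F, ContDiffOn ℝ ∞ f U) (hFF' : F ⊆ F') (k : Fin n)
    (hpd : ∀ f ∈ F, pd k f ∈ F') (hh : SmoothComb U F h) : SmoothComb U F' (pd k h) := by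
  induction hh with
  | zero => exact zero.congr fun x _ => by simp [pd]
  | @mul c f hc hf =>
    refine (add (mul (contDiffOn_pd hU hc k) (hFF' hf)) (mul hc (hpd f hf))).congr fun x hx => ?_
    exact pd_mul (hc.differentiableAt_of_mem_isOpen hU hx)
      ((hF f hf).differentiableAt_of_mem_isOpen hU hx) k
  | add hh₁ hh₂ h₁ h₂ =>
    refine (add h₁ h₂).congr fun x hx => ?_
    exact pd_add ((hh₁.contDiffOn hF).differentiableAt_of_mem_isOpen hU hx)
      ((hh₂.contDiffOn hF).differentiableAt_of_mem_isOpen hU hx) k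
  | congr _ heq ih => exact ih.congr (eqOn_pd hU heq k)

/-- A smooth combination of the components of a vector-valued function is locally bounded by a
multiple of its norm. -/
theorem eventually_abs_le {ι : Type*} [Fintype ι] {V : (Fin n → ℝ) → ι → ℝ}
    (hU : IsOpen U) (hh : SmoothComb U (Set.range fun a x => V x a) h) {q : Fin n → ℝ}
    (hq : q ∈ U) : ∃ C : ℝ, 0 ≤ C ∧ ∀ᶠ x in 𝓝 q, |h x| ≤ C * ‖V x‖ := by
  induction hh with
  | zero => exact ⟨0, le_rfl, by simp⟩
  | @mul c f hc hf =>
    obtain ⟨a, rfl⟩ := hf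
    have hcq : ContinuousAt (fun x => |c x|) q :=
      (hc.continuousOn.continuousAt (hU.mem_nhds hq)).abs
    refine ⟨|c q| + 1, by positivity, ?_⟩
    filter_upwards [hcq.eventually_lt_const (lt_add_one _)] with x hx
    rw [abs_mul]
    exact mul_le_mul hx.le (norm_le_pi_norm (V x) a) (abs_nonneg _) (by positivity)
  | add _ _ h₁ h₂ =>
    obtain ⟨C₁, hC₁, h₁⟩ := h₁
    obtain ⟨C₂, hC₂, h₂⟩ := h₂
    refine ⟨C₁ + C₂, add_nonneg hC₁ hC₂, ?_⟩
    filter_upwards [h₁, h₂] with x hx₁ hx₂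
    rw [add_mul]
    exact (abs_add_le _ _).trans (add_le_add hx₁ hx₂)
  | congr _ heq ih =>
    obtain ⟨C, hC, ih⟩ := ih
    refine ⟨C, hC, ?_⟩
    filter_upwards [ih, hU.mem_nhds hq] with x hx hxU
    rwa [heq hxU]

end SmoothComb

/-- A solution of a closed first order linear system `∂ₖ V = Aₖ V` with smooth coefficients on a
connected open set vanishes identically if it vanishes at one point. -/
theorem eqOn_zero_of_smoothComb_pd {n : ℕ} {U : Set (Fin n → ℝ)} (hUo : IsOpen U)
    (hUc : IsConnected U) {ι : Type*} [Fintype ι] {V : (Fin n → ℝ) → ι → ℝ}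
    (hV : ∀ a, ContDiffOn ℝ ∞ (fun x => V x a) U)
    (hpd : ∀ k a, SmoothComb U (Set.range fun b x => V x b) (pd k fun x => V x a))
    {p : Fin n → ℝ} (hp : p ∈ U) (hVp : V p = 0) : ∀ x ∈ U, V x = 0 := by
  have hopen : IsOpen {x | x ∈ U ∧ V x = 0} := by
    rw [Metric.isOpen_iff]
    rintro q ⟨hq, hVq⟩
    choose C hC hbound using fun k a => (hpd k a).eventually_abs_le hUo hq
    have hev : ∀ᶠ x in 𝓝 q, x ∈ U ∧ ∀ k a, |pd k (fun y => V y a) x| ≤ C k a * ‖V x‖ := by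
      simp only [Filter.eventually_and, Filter.eventually_all]
      exact ⟨hUo.mem_nhds hq, hbound⟩
    obtain ⟨r, hr, hball⟩ := Metric.eventually_nhds_iff_ball.1 hev
    refine ⟨r, hr, fun x hx => ⟨(hball x hx).1, ?_⟩⟩
    have hseg (t : ℝ) (ht : t ∈ Set.Icc (0 : ℝ) 1) : q + t • (x - q) ∈ Metric.ball q r :=
      (convex_ball q r).add_smul_sub_mem (Metric.mem_ball_self hr) hx ht
    have hderiv (t : ℝ) (ht : t ∈ Set.Icc (0 : ℝ) 1) :
        HasDerivAt (fun t : ℝ => V (q + t • (x - q)))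
          (fun a => ∑ k, (x - q) k * pd k (fun y => V y a) (q + t • (x - q))) t := by
      rw [hasDerivAt_pi]
      intro a
      have hline : HasDerivAt (fun t : ℝ => q + t • (x - q)) (x - q) t := by
        simpa using ((hasDerivAt_id t).smul_const (x - q)).const_add q
      have := ((hV a).differentiableAt_of_mem_isOpen hUo
        (hball _ (hseg t ht)).1).hasFDerivAt.comp_hasDerivAt t hline
      rwa [fderiv_apply_eq_sum_pd] at this
    have hzero := eq_zero_of_abs_deriv_le_mul_abs_self_of_eq_zero_right
      (f := fun t : ℝ => V (q + t • (x - q))) (K := ∑ k, ∑ a, |(x - q) k| * C k a)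
      (fun t ht => (hderiv t ht).continuousAt.continuousWithinAt)
      (fun t ht => (hderiv t (Set.Ico_subset_Icc_self ht)).hasDerivWithinAt)
      (by simpa using hVq)
      (fun t ht => by
        have hb := (hball _ (hseg t (Set.Ico_subset_Icc_self ht))).2
        refine (pi_norm_le_iff_of_nonneg ?_).2 fun a => ?_
        · exact mul_nonneg (Finset.sum_nonneg fun k _ => Finset.sum_nonneg fun a _ =>
            mul_nonneg (abs_nonneg _) (hC k a)) (norm_nonneg _)
        · rw [Finset.sum_mul, Real.norm_eq_abs]
          refine (Finset.abs_sum_le_sum_abs _ _).trans (Finset.sum_le_sum fun k _ => ?_)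
          rw [abs_mul]
          refine (mul_le_mul_of_nonneg_left (hb k a) (abs_nonneg _)).trans ?_
          rw [← mul_assoc]
          refine mul_le_mul_of_nonneg_right ?_ (norm_nonneg _)
          exact Finset.single_le_sum (f := fun a => |(x - q) k| * C k a)
            (fun a _ => mul_nonneg (abs_nonneg _) (hC k a)) (Finset.mem_univ a))
    simpa using hzero 1 (by simp)
  have hsub := hUc.isPreconnected.subset_of_closure_inter_subset hopen ⟨p, hp, hp, hVp⟩ <| by
    rintro x ⟨hxcl, hxU⟩
    refine ⟨hxU, ?_⟩
    have hVx : ContinuousAt V x :=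
      continuousAt_pi.2 fun a => (hV a).continuousOn.continuousAt (hUo.mem_nhds hxU)
    have := mem_closure_iff_frequently.1 hxcl
    by_contra hne
    exact this ((hVx.eventually_ne hne).mono fun y hy hy' => hy hy'.2)
  exact fun x hx => (hsub hx).2

section Geodesics

variable {n : ℕ} {U : Set (Fin n → ℝ)} {g : (Fin n → ℝ) → Matrix (Fin n) (Fin n) ℝ}

theorem contDiffOn_det {ι : Type*} [Fintype ι] [DecidableEq ι]
    {A : (Fin n → ℝ) → Matrix ι ι ℝ} (hA : ∀ i j, ContDiffOn ℝ ∞ (fun x => A x i j) U) :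
    ContDiffOn ℝ ∞ (fun x => (A x).det) U := by
  simp only [Matrix.det_apply']
  exact ContDiffOn.sum fun σ _ => contDiffOn_const.mul (contDiffOn_prod fun i _ => hA _ _)

theorem IsMetricOn.contDiffOn_inv (hg : IsMetricOn U g) (i j : Fin n) :
    ContDiffOn ℝ ∞ (fun x => (g x)⁻¹ i j) U := by
  have hdet : ContDiffOn ℝ ∞ (fun x => (g x).det) U := contDiffOn_det hg.smooth
  have hadj : ContDiffOn ℝ ∞ (fun x => (g x).adjugate i j) U := by
    simp only [Matrix.adjugate_apply]
    refine contDiffOn_det fun a b => ?_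
    simp only [Matrix.updateRow_apply]
    split_ifs
    · exact contDiffOn_const
    · exact hg.smooth a b
  refine ((hdet.inv fun x hx => (hg.nondeg x hx).ne_zero).mul hadj).congr fun x _ => ?_
  simp [Matrix.inv_def, Ring.inverse_eq_inv']

theorem IsMetricOn.contDiffOn_Gamma (hU : IsOpen U) (hg : IsMetricOn U g) (k i j : Fin n) :
    ContDiffOn ℝ ∞ (Gamma g k i j) U := by
  unfold Gamma
  refine contDiffOn_const.mul (ContDiffOn.sum fun l _ => (hg.contDiffOn_inv k l).mul ?_)
  exact ((contDiffOn_pd hU (hg.smooth l j) i).add (contDiffOn_pd hU (hg.smooth l i) j)).sub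
    (contDiffOn_pd hU (hg.smooth i j) l)

/-- The geodesic vector field on the tangent bundle `U × ℝⁿ`. -/
noncomputable def geodesicField {n : ℕ} (g : (Fin n → ℝ) → Matrix (Fin n) (Fin n) ℝ)
    (z : (Fin n → ℝ) × (Fin n → ℝ)) : (Fin n → ℝ) × (Fin n → ℝ) :=
  (z.2, fun k => -∑ i, ∑ j, Gamma g k i j z.1 * z.2 i * z.2 j)

theorem IsMetricOn.contDiffOn_geodesicField (hU : IsOpen U) (hg : IsMetricOn U g) :
    ContDiffOn ℝ ∞ (geodesicField g) (U ×ˢ Set.univ) := by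
  have hsnd (i : Fin n) : ContDiffOn ℝ ∞
      (fun z : (Fin n → ℝ) × (Fin n → ℝ) => z.2 i) (U ×ˢ Set.univ) :=
    ((contDiff_apply ℝ ℝ i).comp contDiff_snd).contDiffOn
  refine contDiffOn_snd.prodMk (contDiffOn_pi.2 fun k => ?_)
  refine (ContDiffOn.sum fun i _ => ContDiffOn.sum fun j _ => ?_).neg
  refine ContDiffOn.mul (ContDiffOn.mul ?_ (hsnd i)) (hsnd j)
  exact (hg.contDiffOn_Gamma hU k i j).comp contDiffOn_fst fun z hz => hz.1

/-- Through every point of `U` and in every direction there is a (local) geodesic. -/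
theorem IsMetricOn.exists_geodesic (hU : IsOpen U) (hg : IsMetricOn U g) {q : Fin n → ℝ}
    (hq : q ∈ U) (v : Fin n → ℝ) :
    ∃ (γ : ℝ → Fin n → ℝ) (I : Set ℝ), IsGeodesicOn U g γ I ∧ 0 ∈ I ∧ γ 0 = q ∧
      ∀ k, deriv (fun s => γ s k) 0 = v k := by
  have hopen : IsOpen (U ×ˢ (Set.univ : Set (Fin n → ℝ))) := hU.prod isOpen_univ
  have hqv : (q, v) ∈ U ×ˢ (Set.univ : Set (Fin n → ℝ)) := ⟨hq, Set.mem_univ _⟩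
  have hF := hg.contDiffOn_geodesicField hU
  obtain ⟨α, hα0, ε, hε, hα⟩ :=
    ((hF.contDiffAt (hopen.mem_nhds hqv)).of_le
      (by simp)).exists_forall_mem_closedBall_exists_eq_forall_mem_Ioo_hasDerivAt₀ 0
  simp only [zero_sub, zero_add] at hα
  have hev : ∀ᶠ t in 𝓝 (0 : ℝ), α t ∈ U ×ˢ (Set.univ : Set (Fin n → ℝ)) := by
    refine (hα 0 ⟨by linarith, hε⟩).continuousAt.eventually_mem (hopen.mem_nhds ?_)
    rwa [hα0]
  obtain ⟨δ, hδ, hball⟩ := Metric.eventually_nhds_iff.1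
    (hev.and (Ioo_mem_nhds (neg_lt_zero.2 hε) hε))
  have hIcc : ∀ t ∈ Set.Icc (-(δ / 2)) (δ / 2),
      α t ∈ U ×ˢ (Set.univ : Set (Fin n → ℝ)) ∧ t ∈ Set.Ioo (-ε) ε := fun t ht => by
    refine hball ?_
    rw [Real.dist_eq, sub_zero]
    exact (abs_le.2 ht).trans_lt (half_lt_self hδ)
  have hsmooth : ContDiffOn ℝ ∞ α (Set.Icc (-(δ / 2)) (δ / 2)) := by
    refine ODE.contDiffOn_enat_Icc_of_hasDerivWithinAt (f := fun _ => geodesicField g)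
      (u := U ×ˢ Set.univ) ?_ (fun t ht => (hα t (hIcc t ht).2).hasDerivWithinAt)
      (fun t ht => (hIcc t ht).1)
    exact hF.comp contDiffOn_snd fun z hz => hz.2
  have hsub : Set.Ioo (-(δ / 2)) (δ / 2) ⊆ Set.Icc (-(δ / 2)) (δ / 2) := Set.Ioo_subset_Icc_self
  have hfst (k : Fin n) (t : ℝ) (ht : t ∈ Set.Ioo (-(δ / 2)) (δ / 2)) :
      HasDerivAt (fun s => (α s).1 k) ((α t).2 k) t :=
    hasDerivAt_pi.1 (hα t (hIcc t (hsub ht)).2).fst k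
  have hsnd (k : Fin n) (t : ℝ) (ht : t ∈ Set.Ioo (-(δ / 2)) (δ / 2)) :
      HasDerivAt (fun s => (α s).2 k)
        (-∑ i, ∑ j, Gamma g k i j (α t).1 * (α t).2 i * (α t).2 j) t :=
    hasDerivAt_pi.1 (hα t (hIcc t (hsub ht)).2).snd k
  have h0 : (0 : ℝ) ∈ Set.Ioo (-(δ / 2)) (δ / 2) := ⟨by linarith, by linarith⟩
  refine ⟨fun t => (α t).1, Set.Ioo (-(δ / 2)) (δ / 2),
    ⟨⟨isOpen_Ioo, Set.ordConnected_Ioo⟩, fun k => ?_, fun t ht => (hIcc t (hsub ht)).1.1,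
      fun t ht k => ?_⟩, h0, by simp [hα0], fun k => ?_⟩
  · exact ((contDiff_apply ℝ ℝ k).comp contDiff_fst).comp_contDiffOn (hsmooth.mono hsub)
  · have hderiv : deriv (fun s => (α s).1 k) =ᶠ[𝓝 t] fun s => (α s).2 k :=
      Filter.eventuallyEq_of_mem (isOpen_Ioo.mem_nhds ht) fun s hs => (hfst k s hs).deriv
    rw [hderiv.deriv_eq, (hsnd k t ht).deriv]
    simp only [(hfst _ t ht).deriv, neg_add_cancel]
  · rw [(hfst k 0 h0).deriv, hα0]

end Geodesics

section KillingEquation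

variable {n : ℕ} {U : Set (Fin n → ℝ)} {g K : (Fin n → ℝ) → Matrix (Fin n) (Fin n) ℝ}

/-- The cubic form `v ↦ ∇_k K_{ij} vⁱ vʲ vᵏ` of a Killing tensor vanishes. -/
theorem IsKillingTensorOn.sum_covDeriv2_eq_zero (hU : IsOpen U) (hg : IsMetricOn U g)
    (hKs : ∀ i j, ContDiffOn ℝ ∞ (fun x => K x i j) U) (hK : IsKillingTensorOn U g K)
    {q : Fin n → ℝ} (hq : q ∈ U) (v : Fin n → ℝ) :
    ∑ i, ∑ j, ∑ k, covDeriv2 g K k i j q * v i * v j * v k = 0 := by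
  obtain ⟨γ, I, hγ, h0, hγ0, hv⟩ := hg.exists_geodesic hU hq v
  have hI : I ∈ 𝓝 (0 : ℝ) := hγ.interval.1.mem_nhds h0
  have hγs (i : Fin n) : ContDiffAt ℝ ∞ (fun s => γ s i) 0 := (hγ.smooth i).contDiffAt hI
  have hγd : HasDerivAt γ v 0 := by
    rw [hasDerivAt_pi]
    intro i
    rw [← hv i]
    exact ((hγs i).differentiableAt (by simp)).hasDerivAt
  have hw (i : Fin n) : HasDerivAt (deriv fun s => γ s i)
      (-∑ a, ∑ b, Gamma g i a b q * v a * v b) 0 := by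
    have hds : ContDiffOn ℝ ∞ (deriv fun s => γ s i) I :=
      ((contDiffOn_infty_iff_deriv_of_isOpen hγ.interval.1).1 (hγ.smooth i)).2
    have heq := hγ.eqn 0 h0 i
    simp only [hγ0, hv] at heq
    rw [← eq_neg_of_add_eq_zero_left heq]
    exact ((hds.contDiffAt hI).differentiableAt (by simp)).hasDerivAt
  have hKγ (i j : Fin n) : HasDerivAt (fun s => K (γ s) i j)
      (∑ k, v k * pd k (fun y => K y i j) q) 0 := by
    have hKq : HasFDerivAt (fun y => K y i j) (fderiv ℝ (fun y => K y i j) q) (γ 0) := by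
      rw [hγ0]
      exact ((hKs i j).differentiableAt_of_mem_isOpen hU hq).hasFDerivAt
    rw [← fderiv_apply_eq_sum_pd]
    exact hKq.comp_hasDerivAt 0 hγd
  have hderiv := HasDerivAt.fun_sum (u := Finset.univ) fun i _ =>
    HasDerivAt.fun_sum (u := Finset.univ) fun j _ => ((hw i).mul (hKγ i j)).mul (hw j)
  have hconst := hderiv.unique <| (hasDerivAt_const (0 : ℝ)
    (∑ i, ∑ j, deriv (fun s => γ s i) 0 * K (γ 0) i j * deriv (fun s => γ s j) 0)).congr_of_eventuallyEq
      (Filter.eventuallyEq_of_mem hI fun t ht => hK γ I hγ t ht 0 h0)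
  simp only [Pi.mul_apply, hγ0, hv] at hconst
  have hleft : ∑ i, ∑ j, (-∑ a, ∑ b, Gamma g i a b q * v a * v b) * K q i j * v j =
      -∑ i, ∑ j, ∑ k, (∑ s, Gamma g s k i q * K q s j) * v i * v j * v k := by
    simp only [neg_mul, Finset.sum_neg_distrib, Finset.sum_mul, neg_inj]
    rw [Finset.sum_comm]
    conv_rhs => rw [Finset.sum_comm]
    refine Finset.sum_congr rfl fun j _ => ?_
    rw [Finset.sum_comm]
    conv_rhs => rw [Finset.sum_comm]
    refine Finset.sum_congr rfl fun k _ => ?_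
    rw [Finset.sum_comm]
    exact Finset.sum_congr rfl fun i _ => Finset.sum_congr rfl fun s _ => by ring
  have hright : ∑ i, ∑ j, v i * K q i j * (-∑ a, ∑ b, Gamma g j a b q * v a * v b) =
      -∑ i, ∑ j, ∑ k, (∑ s, Gamma g s k j q * K q i s) * v i * v j * v k := by
    simp only [mul_neg, Finset.sum_neg_distrib, Finset.sum_mul, Finset.mul_sum, neg_inj]
    refine Finset.sum_congr rfl fun i _ => ?_
    rw [Finset.sum_comm]
    conv_rhs => rw [Finset.sum_comm]
    refine Finset.sum_congr rfl fun k _ => ?_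
    rw [Finset.sum_comm]
    exact Finset.sum_congr rfl fun j _ => Finset.sum_congr rfl fun s _ => by ring
  have hmid : ∑ i, ∑ j, v i * (∑ k, v k * pd k (fun y => K y i j) q) * v j =
      ∑ i, ∑ j, ∑ k, pd k (fun y => K y i j) q * v i * v j * v k := by
    simp only [Finset.sum_mul, Finset.mul_sum]
    exact Finset.sum_congr rfl fun i _ => Finset.sum_congr rfl fun j _ =>
      Finset.sum_congr rfl fun k _ => by ring
  simp only [add_mul, Finset.sum_add_distrib, hleft, hright, hmid] at hconst
  simp only [covDeriv2, sub_mul, Finset.sum_sub_distrib]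
  linear_combination hconst

/-- Polarization: the symmetrization of the coefficients of a vanishing cubic form is zero. -/
theorem sum_perm_eq_zero_of_cubic_eq_zero {B : Fin n → Fin n → Fin n → ℝ}
    (hB : ∀ v : Fin n → ℝ, ∑ i, ∑ j, ∑ k, B i j k * v i * v j * v k = 0) (i j k : Fin n) :
    B i j k + B i k j + B j i k + B j k i + B k i j + B k j i = 0 := by
  let Φ (u v w : Fin n → ℝ) : ℝ := ∑ i, ∑ j, ∑ k, B i j k * u i * v j * w k
  have hΦ (u : Fin n → ℝ) : Φ u u u = 0 := hB u
  have hadd₁ (u u' v w) : Φ (u + u') v w = Φ u v w + Φ u' v w := by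
    simp only [Φ, Pi.add_apply, mul_add, add_mul, Finset.sum_add_distrib]
  have hadd₂ (u v v' w) : Φ u (v + v') w = Φ u v w + Φ u v' w := by
    simp only [Φ, Pi.add_apply, mul_add, add_mul, Finset.sum_add_distrib]
  have hadd₃ (u v w w') : Φ u v (w + w') = Φ u v w + Φ u v w' := by
    simp only [Φ, Pi.add_apply, mul_add, Finset.sum_add_distrib]
  have hsingle (a b c : Fin n) :
      Φ (Pi.single a 1) (Pi.single b 1) (Pi.single c 1) = B a b c := by
    simp [Φ, Pi.single_apply]
  have hpol (u v w : Fin n → ℝ) :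
      Φ u v w + Φ u w v + Φ v u w + Φ v w u + Φ w u v + Φ w v u = 0 := by
    have h₁ := hΦ (u + v + w)
    have h₂ := hΦ (u + v)
    have h₃ := hΦ (u + w)
    have h₄ := hΦ (v + w)
    simp only [hadd₁, hadd₂, hadd₃] at h₁ h₂ h₃ h₄
    linear_combination h₁ - h₂ - h₃ - h₄ + hΦ u + hΦ v + hΦ w
  simpa only [hsingle] using hpol (Pi.single i 1) (Pi.single j 1) (Pi.single k 1)

/-- The partial derivatives of order at most `m` of the components of `K`. -/
def jetComponents {n : ℕ} (K : (Fin n → ℝ) → Matrix (Fin n) (Fin n) ℝ) (m : ℕ) :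
    Set ((Fin n → ℝ) → ℝ) :=
  {f | ∃ l : List (Fin n), l.length ≤ m ∧ ∃ i j, f = iterPD l fun x => K x i j}

theorem contDiffOn_of_mem_jetComponents (hU : IsOpen U)
    (hKs : ∀ i j, ContDiffOn ℝ ∞ (fun x => K x i j) U) {m : ℕ} {f : (Fin n → ℝ) → ℝ}
    (hf : f ∈ jetComponents K m) : ContDiffOn ℝ ∞ f U := by
  obtain ⟨l, _, i, j, rfl⟩ := hf
  exact contDiffOn_iterPD hU (hKs i j) l

theorem SmoothComb.pd_jetComponents (hU : IsOpen U)
    (hKs : ∀ i j, ContDiffOn ℝ ∞ (fun x => K x i j) U) {m : ℕ} {h : (Fin n → ℝ) → ℝ}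
    (hh : SmoothComb U (jetComponents K m) h) (k : Fin n) :
    SmoothComb U (jetComponents K (m + 1)) (pd k h) := by
  refine hh.pd_mem hU (fun f => contDiffOn_of_mem_jetComponents hU hKs) ?_ k ?_
  · rintro f ⟨l, hl, i, j, rfl⟩
    exact ⟨l, hl.trans (Nat.le_succ m), i, j, rfl⟩
  · rintro f ⟨l, hl, i, j, rfl⟩
    exact ⟨k :: l, Nat.succ_le_succ hl, i, j, rfl⟩

/-- The Killing equation: `∂_c K_{de} + ∂_d K_{ce} + ∂_e K_{cd}` is an algebraic expression
in `K`. -/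
theorem IsKillingTensorOn.smoothComb_cyclic_pd (hU : IsOpen U) (hg : IsMetricOn U g)
    (hKs : ∀ i j, ContDiffOn ℝ ∞ (fun x => K x i j) U) (hKsym : ∀ x ∈ U, (K x).IsSymm)
    (hK : IsKillingTensorOn U g K) (c d e : Fin n) :
    SmoothComb U (jetComponents K 0) (fun x => pd c (fun y => K y d e) x +
      pd d (fun y => K y c e) x + pd e (fun y => K y c d) x) := by
  let R (k i j : Fin n) (x : Fin n → ℝ) : ℝ :=
    (∑ s, Gamma g s k i x * K x s j) + ∑ s, Gamma g s k j x * K x i s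
  have hmem (i j : Fin n) : (fun x => K x i j) ∈ jetComponents K 0 := ⟨[], le_rfl, i, j, rfl⟩
  have hR (k i j : Fin n) : SmoothComb U (jetComponents K 0) (R k i j) :=
    .add (.sum _ fun s _ => .mul (hg.contDiffOn_Gamma hU s k i) (hmem s j))
      (.sum _ fun s _ => .mul (hg.contDiffOn_Gamma hU s k j) (hmem i s))
  have hsymm (k i j : Fin n) :
      Set.EqOn (pd k fun y => K y i j) (pd k fun y => K y j i) U :=
    eqOn_pd hU (fun y hy => (hKsym y hy).apply j i) k
  refine (SmoothComb.const_mul (1 / 2) <| (hR e c d).add <| (hR d c e).add <| (hR e d c).add <|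
    (hR c d e).add <| (hR d e c).add (hR c e d)).congr fun x hx => ?_
  have hsum := sum_perm_eq_zero_of_cubic_eq_zero
    (hK.sum_covDeriv2_eq_zero hU hg hKs hx) c d e
  simp only [covDeriv2] at hsum
  simp only [R]
  linear_combination (1 / 2) * hsum + (1 / 2) * hsymm c d e hx + (1 / 2) * hsymm d c e hx +
    (1 / 2) * hsymm e c d hx

theorem IsKillingTensorOn.smoothComb_pd_pd_cyclic (hU : IsOpen U) (hg : IsMetricOn U g)
    (hKs : ∀ i j, ContDiffOn ℝ ∞ (fun x => K x i j) U) (hKsym : ∀ x ∈ U, (K x).IsSymm)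
    (hK : IsKillingTensorOn U g K) (a b c d e : Fin n) :
    SmoothComb U (jetComponents K 2) (fun x => iterPD [a, b, c] (fun y => K y d e) x +
      iterPD [a, b, d] (fun y => K y c e) x + iterPD [a, b, e] (fun y => K y c d) x) := by
  have hpd (l : List (Fin n)) (k : Fin n) : Set.EqOn
      (pd k fun x => iterPD (l ++ [c]) (fun y => K y d e) x +
        iterPD (l ++ [d]) (fun y => K y c e) x + iterPD (l ++ [e]) (fun y => K y c d) x)
      (fun x => iterPD (k :: l ++ [c]) (fun y => K y d e) x +
        iterPD (k :: l ++ [d]) (fun y => K y c e) x + iterPD (k :: l ++ [e]) (fun y => K y c d) x)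
      U := fun x hx => by
    have hd (l : List (Fin n)) (i j : Fin n) :
        DifferentiableAt ℝ (iterPD l fun y => K y i j) x :=
      (contDiffOn_iterPD hU (hKs i j) l).differentiableAt_of_mem_isOpen hU hx
    refine (pd_add ((hd _ _ _).fun_add (hd _ _ _)) (hd _ _ _) k).trans ?_
    exact congrArg (· + _) (pd_add (hd _ _ _) (hd _ _ _) k)
  have h := ((hK.smoothComb_cyclic_pd hU hg hKs hKsym c d e).pd_jetComponents hU hKs
    b).pd_jetComponents hU hKs a
  exact h.congr fun x hx => ((eqOn_pd hU (hpd [] b) a hx).trans (hpd [b] a hx)).symm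

/-- Prolongation of the Killing equation: the third derivatives of a Killing tensor are linear
combinations of its derivatives of order at most two. -/
theorem IsKillingTensorOn.smoothComb_third (hU : IsOpen U) (hg : IsMetricOn U g)
    (hKs : ∀ i j, ContDiffOn ℝ ∞ (fun x => K x i j) U) (hKsym : ∀ x ∈ U, (K x).IsSymm)
    (hK : IsKillingTensorOn U g K) (a b c d e : Fin n) :
    SmoothComb U (jetComponents K 2) (iterPD [a, b, c] fun y => K y d e) := by
  have s := hK.smoothComb_pd_pd_cyclic hU hg hKs hKsym
  refine (SmoothComb.add
    (((s a b c d e).add ((s a c b d e).add ((s b c a d e).add (s d e a b c)))).const_mul (1 / 3))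
    (((s a d b c e).add ((s a e b c d).add ((s b d a c e).add ((s b e a c d).add
      ((s c d a b e).add (s c e a b d)))))).const_mul (-1 / 6))).congr fun x hx => ?_
  have h₁₂ (i j k p q : Fin n) : iterPD [j, i, k] (fun y => K y p q) x =
      iterPD [i, j, k] (fun y => K y p q) x :=
    pd_comm hU (contDiffOn_iterPD hU (hKs p q) [k]) j i hx
  have h₂₃ (i j k p q : Fin n) : iterPD [i, k, j] (fun y => K y p q) x =
      iterPD [i, j, k] (fun y => K y p q) x :=
    eqOn_pd hU (pd_comm hU (hKs p q) k j) i hx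
  have hcyc (i j k p q : Fin n) : iterPD [j, k, i] (fun y => K y p q) x =
      iterPD [i, j, k] (fun y => K y p q) x := by rw [h₂₃, h₁₂]
  linarith [h₂₃ a b c d e, hcyc a b c d e, h₂₃ a b d c e, hcyc a b d c e, h₂₃ a b e c d,
    hcyc a b e c d, h₂₃ a c d b e, hcyc a c d b e, h₂₃ a c e b d, hcyc a c e b d,
    h₂₃ a d e b c, hcyc a d e b c, h₂₃ b c d a e, hcyc b c d a e, h₂₃ b c e a d,
    hcyc b c e a d, h₂₃ b d e a c, hcyc b d e a c, h₂₃ c d e a b, hcyc c d e a b]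

end KillingEquation

theorem Killing_tensor_vanishing_to_order_two_is_zero {n : ℕ} (hn : 2 ≤ n) (U : Set (Fin n → ℝ)) (hUo : IsOpen U) (hUc : IsConnected U)
    (g : (Fin n → ℝ) → Matrix (Fin n) (Fin n) ℝ) (hg : IsMetricOn U g)
    (K : (Fin n → ℝ) → Matrix (Fin n) (Fin n) ℝ)
    (hKs : ∀ i j : Fin n, ContDiffOn ℝ (⊤ : ℕ∞) (fun x => K x i j) U)
    (hKsym : ∀ x ∈ U, (K x).IsSymm)
    (hK : IsKillingTensorOn U g K)
    (p : Fin n → ℝ) (hp : p ∈ U)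
    (hvan : ∀ i j : Fin n, VanishUpTo 2 (fun x => K x i j) p) :
    ∀ x ∈ U, K x = 0 := by
  have hfin : Finite {l : List (Fin n) // l.length ≤ 2} := List.finite_length_le (Fin n) 2
  have := Fintype.ofFinite {l : List (Fin n) // l.length ≤ 2}
  let V (x : Fin n → ℝ) (a : {l : List (Fin n) // l.length ≤ 2} × Fin n × Fin n) : ℝ :=
    iterPD a.1.1 (fun y => K y a.2.1 a.2.2) x
  have hrange : jetComponents K 2 ⊆ Set.range fun a x => V x a := by
    rintro f ⟨l, hl, i, j, rfl⟩
    exact ⟨(⟨l, hl⟩, i, j), rfl⟩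
  have hthird (k : Fin n) (l : List (Fin n)) (hl : l.length ≤ 2) (i j : Fin n) :
      SmoothComb U (jetComponents K 2) (iterPD (k :: l) fun y => K y i j) := by
    match l, hl with
    | [], _ => exact .of_mem ⟨[k], by simp, i, j, rfl⟩
    | [a], _ => exact .of_mem ⟨[k, a], by simp, i, j, rfl⟩
    | [a, b], _ => exact hK.smoothComb_third hUo hg hKs hKsym k a b i j
  have hzero := eqOn_zero_of_smoothComb_pd hUo hUc (V := V)
    (fun a => contDiffOn_iterPD hUo (hKs _ _) _)
    (fun k a => (hthird k a.1.1 a.1.2 a.2.1 a.2.2).mono hrange) hp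
    (funext fun a => hvan _ _ a.1.1 a.1.2)
  intro x hx
  ext i j
  exact congrFun (hzero x hx) (⟨[], by simp⟩, i, j)
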